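/- arXiv:1702.02661 — 3 statements merged into one kernel-verified Lean document; each statement's English description precedes it below -/
import Mathlib

section
/- In the FLR model with d = n and F = I_n, suppose W = XΛYᵀ + M where Λ ∈ ℝ^{r×r} is diagonal, X, Y ∈ ℝ^{n×r} have orthonormal columns, and M ∈ ℝ^{n×n} is symmetric. Then the entrywise logit transform satisfies ψ(P) = 1wᵀ − w1ᵀ + YΛXᵀ − XΛYᵀ, and rank(ψ(P)) ≤ 2r + 2. -/
open Matrix

/-- The logit of `e^{-a} / (e^{-a} + e^{-b})` is `b - a`. -/
lemma log_odds_exp_neg (a b : ℝ) :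
    Real.log (Real.exp (-a) / (Real.exp (-a) + Real.exp (-b)) /
      (1 - Real.exp (-a) / (Real.exp (-a) + Real.exp (-b)))) = b - a := by
  have ha := Real.exp_pos (-a)
  have hb := Real.exp_pos (-b)
  have h : Real.exp (-a) / (Real.exp (-a) + Real.exp (-b)) /
      (1 - Real.exp (-a) / (Real.exp (-a) + Real.exp (-b))) =
      Real.exp (-a) / Real.exp (-b) := by
    rw [one_sub_div (by positivity), add_sub_cancel_left]
    field_simp
  rw [h, ← Real.exp_sub, Real.log_exp]
  ring

lemma rank_add_le_rank_add_rank {m n K : Type*} [Fintype m] [Fintype n] [Field K]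
    (A B : Matrix m n K) :
    (A + B).rank ≤ A.rank + B.rank := by
  unfold Matrix.rank
  rw [Matrix.mulVecLin_add]
  exact (Submodule.finrank_mono (LinearMap.range_add_le _ _)).trans
    (Submodule.finrank_add_le_finrank_add_finrank _ _)

lemma rank_mul_mul_le_inner {m n K : Type*} [Fintype n] [Field K] {r : ℕ}
    (A : Matrix m (Fin r) K) (B : Matrix (Fin r) (Fin r) K) (C : Matrix (Fin r) n K) :
    (A * B * C).rank ≤ r :=
  (rank_mul_le_left _ _).trans ((rank_le_card_width _).trans_eq (Fintype.card_fin r))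

/-- In the FLR model with `d = n`, `F = I` and
`W = X Λ Yᵀ + M` (`Λ` diagonal `r × r`, `X, Y` with orthonormal columns, `M` symmetric),
the entrywise logit transform satisfies `ψ(P) = 1 wᵀ − w 1ᵀ + Y Λ Xᵀ − X Λ Yᵀ`
and `rank (ψ(P)) ≤ 2 r + 2`. -/
theorem flr_low_rank_plus_symmetric_W {n r : ℕ} (w : Fin n → ℝ)
    (F : Matrix (Fin n) (Fin n) ℝ) (hF : F = 1)
    (Λ : Matrix (Fin r) (Fin r) ℝ) (hΛ : Λ.IsDiag)
    (X Y : Matrix (Fin n) (Fin r) ℝ)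
    (hX : Xᵀ * X = 1) (hY : Yᵀ * Y = 1)
    (M : Matrix (Fin n) (Fin n) ℝ) (hM : M.IsSymm)
    (W : Matrix (Fin n) (Fin n) ℝ) (hW : W = X * Λ * Yᵀ + M)
    (E : Fin n → Fin n → ℝ)
    (hE : ∀ i j, E i j =
      (fun k => F k i) ⬝ᵥ w + (fun k => F k i) ⬝ᵥ (W *ᵥ (fun k => F k j)))
    (P : Matrix (Fin n) (Fin n) ℝ)
    (hP : ∀ i j, P i j = Real.exp (-E i j) / (Real.exp (-E i j) + Real.exp (-E j i)))
    (ψP : Matrix (Fin n) (Fin n) ℝ)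
    (hψP : ∀ i j, ψP i j = Real.log (P i j / (1 - P i j))) :
    ψP = vecMulVec (fun _ => (1 : ℝ)) w - vecMulVec w (fun _ => (1 : ℝ))
          + Y * Λ * Xᵀ - X * Λ * Yᵀ ∧
    ψP.rank ≤ 2 * r + 2 := by
  have hψ : ψP = vecMulVec (fun _ => (1 : ℝ)) w - vecMulVec w (fun _ => (1 : ℝ))
      + Y * Λ * Xᵀ - X * Λ * Yᵀ := by
    have hE' : ∀ i j, E i j = w i + W i j := by
      intro i j
      have hcol : ∀ i, (fun k => F k i) = Pi.single i 1 := by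
        intro i
        ext k
        simp [hF, Matrix.one_apply, Pi.single_apply]
      rw [hE, hcol, hcol]
      simp
    have hT : Y * Λ * Xᵀ = (X * Λ * Yᵀ)ᵀ := by
      simp [Matrix.transpose_mul, hΛ.isSymm.eq, Matrix.mul_assoc]
    ext i j
    rw [hψP, hP, log_odds_exp_neg, hE', hE', hT, hW]
    simp only [Matrix.add_apply, Matrix.sub_apply, Matrix.transpose_apply, vecMulVec_apply,
      hM.apply i j]
    ring
  refine ⟨hψ, ?_⟩
  have hsum : ψP = vecMulVec (fun _ => (1 : ℝ)) w + vecMulVec (-w) (fun _ => (1 : ℝ))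
      + Y * Λ * Xᵀ + -X * Λ * Yᵀ := by
    rw [hψ, neg_vecMulVec, Matrix.neg_mul, Matrix.neg_mul, ← sub_eq_add_neg, ← sub_eq_add_neg]
  rw [hsum]
  grw [rank_add_le_rank_add_rank, rank_add_le_rank_add_rank, rank_add_le_rank_add_rank,
    rank_vecMulVec_le, rank_vecMulVec_le, rank_mul_mul_le_inner, rank_mul_mul_le_inner]
  omega
end

section
/- The FLR model admits stochastically intransitive preference matrices: with n = d = 3, F = I_3, w = 0, and W ∈ ℝ^{3×3} given by W_{21} = W_{32} = W_{13} = 1 and all other entries 0, the resulting FLR preference matrix P satisfies P_{12} > 1/2, P_{23} > 1/2 and P_{31} > 1/2 (equivalently P_{13} < 1/2), so P violates stochastic transitivity. -/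
open Matrix

/-- The option of lower energy is preferred with probability more than one half. -/
lemma half_lt_exp_neg_div_iff (a b : ℝ) :
    1 / 2 < Real.exp (-a) / (Real.exp (-a) + Real.exp (-b)) ↔ a < b := by
  rw [lt_div_iff₀ (by positivity), ← neg_lt_neg_iff (a := b) (b := a),
    ← Real.exp_lt_exp (x := -b) (y := -a)]
  constructor <;> intro h <;> linarith

/-- The option of higher energy is preferred with probability less than one half. -/
lemma exp_neg_div_lt_half_iff (a b : ℝ) :
    Real.exp (-a) / (Real.exp (-a) + Real.exp (-b)) < 1 / 2 ↔ b < a := by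
  rw [div_lt_iff₀ (by positivity), ← neg_lt_neg_iff (a := a) (b := b),
    ← Real.exp_lt_exp (x := -a) (y := -b)]
  constructor <;> intro h <;> linarith

/-- The FLR model admits stochastically intransitive preference
matrices: with `n = d = 3`, `F = I₃`, `w = 0` and `W` having `W 1 0 = W 2 1 = W 0 2 = 1`
and all other entries `0`, the FLR preference matrix `P` satisfies `P 0 1 > 1/2`,
`P 1 2 > 1/2`, `P 2 0 > 1/2` (equivalently `P 0 2 < 1/2`), so `P` violates stochastic
transitivity. -/
theorem flr_admits_intransitive {F : Matrix (Fin 3) (Fin 3) ℝ} (hF : F = 1)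
    {w : Fin 3 → ℝ} (hw : w = 0)
    {W : Matrix (Fin 3) (Fin 3) ℝ}
    (hW : W = Matrix.of fun i j : Fin 3 =>
      if (i = 1 ∧ j = 0) ∨ (i = 2 ∧ j = 1) ∨ (i = 0 ∧ j = 2) then (1 : ℝ) else 0)
    {E : Fin 3 → Fin 3 → ℝ}
    (hE : ∀ i j, E i j =
      (fun k => F k i) ⬝ᵥ w + (fun k => F k i) ⬝ᵥ (W *ᵥ (fun k => F k j)))
    {P : Matrix (Fin 3) (Fin 3) ℝ}
    (hP : ∀ i j, P i j = Real.exp (-E i j) / (Real.exp (-E i j) + Real.exp (-E j i))) :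
    P 0 1 > 1 / 2 ∧ P 1 2 > 1 / 2 ∧ P 2 0 > 1 / 2 ∧ P 0 2 < 1 / 2 ∧
    ¬ (∀ i j k : Fin 3, P i j > 1 / 2 → P j k > 1 / 2 → P i k > 1 / 2) := by
  have hEW : ∀ i j, E i j = W i j := by
    intro i j
    subst hF hw
    simp [hE, dotProduct, mulVec, Matrix.one_apply]
  have h01 : P 0 1 > 1 / 2 := by
    rw [hP, gt_iff_lt, half_lt_exp_neg_div_iff, hEW, hEW]; simp [hW]
  have h12 : P 1 2 > 1 / 2 := by
    rw [hP, gt_iff_lt, half_lt_exp_neg_div_iff, hEW, hEW]; simp [hW]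
  have h20 : P 2 0 > 1 / 2 := by
    rw [hP, gt_iff_lt, half_lt_exp_neg_div_iff, hEW, hEW]; simp [hW]
  have h02 : P 0 2 < 1 / 2 := by
    rw [hP, exp_neg_div_lt_half_iff, hEW, hEW]; simp [hW]
  exact ⟨h01, h12, h20, h02, fun h => lt_asymm h02 (h 0 1 2 h01 h12)⟩
end

section
/- Let P, Q ∈ (0,1)^{n×n} with P_{ij} + P_{ji} = 1 for all i, j, let ψ : (0,1) → ℝ be monotone increasing (x ≤ y implies ψ(x) ≤ ψ(y)), and suppose P_{ij} ≠ 1/2 for all i ≠ j. Set Δ := min_{i≠j} |ψ(P_{ij}) − ψ(1/2)| > 0. Then the number of ordered pairs (i,j) with i ≠ j on which Q and P disagree about which item is preferred, namely |{ (i,j) : i ≠ j, (P_{ij} > 1/2 and Q_{ij} ≤ 1/2) or (P_{ij} < 1/2 and Q_{ij} ≥ 1/2) }|, is at most ‖ψ(Q) − ψ(P)‖_F² / Δ², where ψ is applied entrywise. -/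
open Matrix

/-- If `a` and `b` lie on opposite sides of `c` in `s` and `ψ` is monotone on `s`, then `ψ a` is at
least as far from `ψ b` as from `ψ c`. -/
theorem MonotoneOn.abs_sub_le_abs_sub_of_opposite_sides {ψ : ℝ → ℝ} {s : Set ℝ}
    (hψ : MonotoneOn ψ s) {a b c : ℝ} (ha : a ∈ s) (hb : b ∈ s) (hc : c ∈ s)
    (h : (c < a ∧ b ≤ c) ∨ (a < c ∧ c ≤ b)) :
    |ψ a - ψ c| ≤ |ψ b - ψ a| := by
  rcases h with ⟨hca, hbc⟩ | ⟨hac, hcb⟩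
  · have h₁ := hψ hc ha hca.le
    have h₂ := hψ hb hc hbc
    rw [abs_of_nonneg (by linarith), abs_of_nonpos (by linarith)]
    linarith
  · have h₁ := hψ ha hc hac.le
    have h₂ := hψ hc hb hcb
    rw [abs_of_nonpos (by linarith), abs_of_nonneg (by linarith)]
    linarith

/-- The disagreement bound for a link `ψ` that is only monotone on `(0,1)`, where `Δ` is any
positive lower bound for the gaps `|ψ (P i j) - ψ (1 / 2)|`. -/
theorem disagreements_le_of_monotoneOn {n : ℕ}
    (P Q : Matrix (Fin n) (Fin n) ℝ) (ψ : ℝ → ℝ) (Δ : ℝ)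
    (hP : ∀ i j, P i j ∈ Set.Ioo (0 : ℝ) 1)
    (hQ : ∀ i j, Q i j ∈ Set.Ioo (0 : ℝ) 1)
    (hψ : MonotoneOn ψ (Set.Ioo 0 1))
    (hΔ : ∀ i j, i ≠ j → Δ ≤ |ψ (P i j) - ψ (1 / 2)|)
    (hΔpos : 0 < Δ) :
    ((Finset.univ.filter fun p : Fin n × Fin n => p.1 ≠ p.2 ∧
        ((P p.1 p.2 > 1 / 2 ∧ Q p.1 p.2 ≤ 1 / 2) ∨
         (P p.1 p.2 < 1 / 2 ∧ Q p.1 p.2 ≥ 1 / 2))).card : ℝ)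
      ≤ (∑ i, ∑ j, (ψ (Q i j) - ψ (P i j)) ^ 2) / Δ ^ 2 := by
  rw [le_div_iff₀ (by positivity), ← nsmul_eq_mul, ← Fintype.sum_prod_type']
  refine (Finset.card_nsmul_le_sum _
    (fun p : Fin n × Fin n => (ψ (Q p.1 p.2) - ψ (P p.1 p.2)) ^ 2) _ fun p hp => ?_).trans
    (Finset.sum_le_sum_of_subset_of_nonneg (Finset.filter_subset _ _) fun _ _ _ => sq_nonneg _)
  obtain ⟨hij, hdis⟩ := (Finset.mem_filter.mp hp).2
  rw [← sq_abs (_ - _)]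
  exact pow_le_pow_left₀ hΔpos.le ((hΔ _ _ hij).trans
    (hψ.abs_sub_le_abs_sub_of_opposite_sides (hP _ _) (hQ _ _) (by norm_num) hdis)) 2

/-- Let `P, Q` be preference matrices with entries in `(0,1)` and
`P i j + P j i = 1`, let `ψ` be monotone increasing, and suppose `P i j ≠ 1/2` for all
`i ≠ j`, with `Δ = min_{i≠j} |ψ(P i j) − ψ(1/2)| > 0`. Then the number of ordered pairs
`(i,j)`, `i ≠ j`, on which `Q` and `P` disagree about which item is preferred is at most
`‖ψ(Q) − ψ(P)‖_F² / Δ²`. -/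
theorem disagreements_le_frobenius_sq_div_delta_sq {n : ℕ}
    (P Q : Matrix (Fin n) (Fin n) ℝ) (ψ : ℝ → ℝ) (Δ : ℝ)
    (hP0 : ∀ i j, P i j ∈ Set.Ioo (0 : ℝ) 1)
    (hQ0 : ∀ i j, Q i j ∈ Set.Ioo (0 : ℝ) 1)
    (hPsum : ∀ i j, P i j + P j i = 1)
    (hmono : Monotone ψ)
    (hne : ∀ i j, i ≠ j → P i j ≠ 1 / 2)
    (hΔ : IsLeast {x : ℝ | ∃ i j : Fin n, i ≠ j ∧ x = |ψ (P i j) - ψ (1 / 2)|} Δ)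
    (hΔpos : 0 < Δ) :
    ((Finset.univ.filter fun p : Fin n × Fin n => p.1 ≠ p.2 ∧
        ((P p.1 p.2 > 1 / 2 ∧ Q p.1 p.2 ≤ 1 / 2) ∨
         (P p.1 p.2 < 1 / 2 ∧ Q p.1 p.2 ≥ 1 / 2))).card : ℝ)
      ≤ (∑ i, ∑ j, (ψ (Q i j) - ψ (P i j)) ^ 2) / Δ ^ 2 := by
  exact disagreements_le_of_monotoneOn P Q ψ Δ hP0 hQ0 (hmono.monotoneOn _)
    (fun i j hij => hΔ.2 ⟨i, j, hij, rfl⟩) hΔpos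
end
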